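/- Let f : ℝⁿ → ℝ be twice continuously differentiable with μI ⪯ ∇²f(x) ⪯ LI for all x (0 < μ ≤ L, κ = L/μ) and M-strongly self-concordant, and consider the SR1_CS iteration (G₀ = L·I, r_{−1} = 0, x_{k+1} = x_k − G_k⁻¹∇f(x_k), u_k = x_{k+1}−x_k, r_k = ‖u_k‖_{x_k}, G̃_k = (1+Mr_{k−1}/2)(1+Mr_k/2)G_k, J_k = ∫₀¹∇²f(x_k+tu_k)dt, G_{k+1} = SR1(J_k, G̃_k, u_k)) with M·λ_f(x₀) ≤ ln(3/2)/(4κ). Then for all k > 4n·ln(eκ)/ln 2: λ_f(x_k) ≤ (4n·ln(eκ)/k)^{k/2} · √(3κ) · λ_f(x₀), where λ_f(x) = √(∇f(x)ᵀ[∇²f(x)]⁻¹∇f(x)). -/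

import Mathlib

open Matrix

/-- The SR1 quasi-Newton update of `G` with respect to target `A` along direction `u`. -/
noncomputable def SR1 {n : ℕ} (A G : Matrix (Fin n) (Fin n) ℝ) (u : Fin n → ℝ) :
    Matrix (Fin n) (Fin n) ℝ :=
  if (G - A) *ᵥ u = 0 then G
  else G - (u ⬝ᵥ ((G - A) *ᵥ u))⁻¹ • Matrix.vecMulVec ((G - A) *ᵥ u) ((G - A) *ᵥ u)

/-- The Hessian matrix of `f` at `x`, with entries the second derivatives in the
standard basis directions. -/
noncomputable def hess {n : ℕ} (f : (Fin n → ℝ) → ℝ) (x : Fin n → ℝ) :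
    Matrix (Fin n) (Fin n) ℝ :=
  Matrix.of fun i j => iteratedFDeriv ℝ 2 f x ![Pi.single i 1, Pi.single j 1]

/-- The gradient of `f` at `x`. -/
noncomputable def grad {n : ℕ} (f : (Fin n → ℝ) → ℝ) (x : Fin n → ℝ) : Fin n → ℝ :=
  fun i => fderiv ℝ f x (Pi.single i 1)

/-- The local norm `‖v‖_z = √(vᵀ ∇²f(z) v)`. -/
noncomputable def znorm {n : ℕ} (f : (Fin n → ℝ) → ℝ) (z v : Fin n → ℝ) : ℝ :=
  Real.sqrt (v ⬝ᵥ (hess f z *ᵥ v))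

/-- The local gradient norm `λ_f(x) = √(∇f(x)ᵀ [∇²f(x)]⁻¹ ∇f(x))`. -/
noncomputable def lamG {n : ℕ} (f : (Fin n → ℝ) → ℝ) (x : Fin n → ℝ) : ℝ :=
  Real.sqrt (grad f x ⬝ᵥ ((hess f x)⁻¹ *ᵥ grad f x))

/-- `f` is `M`-strongly self-concordant:
`∇²f(y) − ∇²f(x) ⪯ M‖y−x‖_z ∇²f(w)` for all `x, y, z, w`. -/
def StrongSelfConcordant {n : ℕ} (f : (Fin n → ℝ) → ℝ) (M : ℝ) : Prop :=
  ∀ x y z w : Fin n → ℝ,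
    ((M * znorm f z (y - x)) • hess f w - (hess f y - hess f x)).PosSemidef

/-- The averaged Hessian `J_k = ∫₀¹ ∇²f(x_k + t u_k) dt` (entrywise integral),
where `u_k = x_{k+1} − x_k`. -/
noncomputable def Jmat {n : ℕ} (f : (Fin n → ℝ) → ℝ) (x : ℕ → Fin n → ℝ) (k : ℕ) :
    Matrix (Fin n) (Fin n) ℝ :=
  Matrix.of fun i j => ∫ t in (0:ℝ)..(1:ℝ), hess f (x k + t • (x (k+1) - x k)) i j


namespace Matrix

section QuadraticForms

variable {n : ℕ}

lemma IsSymm.dotProduct_mulVec_comm {A : Matrix (Fin n) (Fin n) ℝ} (hA : A.IsSymm)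
    (u v : Fin n → ℝ) : u ⬝ᵥ A *ᵥ v = v ⬝ᵥ A *ᵥ u := by
  rw [dotProduct_mulVec, ← mulVec_transpose, hA, dotProduct_comm]

lemma posSemidef_sub_of_forall_le {A B : Matrix (Fin n) (Fin n) ℝ} (hA : A.IsSymm)
    (hB : B.IsSymm) (h : ∀ v, v ⬝ᵥ A *ᵥ v ≤ v ⬝ᵥ B *ᵥ v) : (B - A).PosSemidef := by
  refine .of_dotProduct_mulVec_nonneg ?_ fun v ↦ ?_
  · rw [IsHermitian, conjTranspose_eq_transpose_of_trivial]
    exact hB.sub hA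
  · simpa [sub_mulVec, dotProduct_sub] using h v

lemma PosSemidef.dotProduct_mulVec_le {A B : Matrix (Fin n) (Fin n) ℝ}
    (h : (B - A).PosSemidef) (v : Fin n → ℝ) : v ⬝ᵥ A *ᵥ v ≤ v ⬝ᵥ B *ᵥ v := by
  simpa [sub_mulVec, dotProduct_sub] using h.dotProduct_mulVec_nonneg v

lemma posDef_of_forall_le {A : Matrix (Fin n) (Fin n) ℝ} (hA : A.IsSymm) {μ : ℝ} (hμ : 0 < μ)
    (h : ∀ v, μ * (v ⬝ᵥ v) ≤ v ⬝ᵥ A *ᵥ v) : A.PosDef := by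
  refine .of_dotProduct_mulVec_pos ?_ fun v hv ↦ ?_
  · rwa [IsHermitian, conjTranspose_eq_transpose_of_trivial]
  · have : 0 < v ⬝ᵥ v := by simpa using dotProduct_star_self_pos_iff.2 hv
    simpa using (mul_pos hμ this).trans_le (h v)

/-- Inversion reverses the Loewner order, phrased without inverses. -/
lemma dotProduct_mulVec_le_of_mulVec_eq {G H : Matrix (Fin n) (Fin n) ℝ} (hH : H.IsSymm)
    (hpos : ∀ v, 0 ≤ v ⬝ᵥ H *ᵥ v) {c : ℝ} (hc : 0 < c)
    (hle : ∀ v, v ⬝ᵥ H *ᵥ v ≤ c * (v ⬝ᵥ G *ᵥ v)) {u y : Fin n → ℝ} (huy : G *ᵥ u = H *ᵥ y) :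
    u ⬝ᵥ G *ᵥ u ≤ c * (y ⬝ᵥ H *ᵥ y) := by
  have h := hpos (u - c • y)
  have hu := hle u
  simp only [mulVec_sub, mulVec_smul, sub_dotProduct, dotProduct_sub, smul_dotProduct,
    dotProduct_smul, smul_eq_mul, hH.dotProduct_mulVec_comm y u, ← huy] at h
  have : 0 ≤ c * (c * (y ⬝ᵥ H *ᵥ y) - u ⬝ᵥ G *ᵥ u) := by rw [← huy]; linarith
  linarith [nonneg_of_mul_nonneg_right this hc]

lemma dotProduct_inv_mulVec_le {G H : Matrix (Fin n) (Fin n) ℝ} (hG : G.PosDef) (hH : H.PosDef)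
    {c : ℝ} (hc : 0 < c) (hle : ∀ v, v ⬝ᵥ H *ᵥ v ≤ c * (v ⬝ᵥ G *ᵥ v)) (g : Fin n → ℝ) :
    g ⬝ᵥ G⁻¹ *ᵥ g ≤ c * (g ⬝ᵥ H⁻¹ *ᵥ g) := by
  have hGu : G *ᵥ G⁻¹ *ᵥ g = g := by
    rw [mulVec_mulVec, mul_nonsing_inv _ hG.det_pos.ne'.isUnit, one_mulVec]
  have hHu : H *ᵥ H⁻¹ *ᵥ g = g := by
    rw [mulVec_mulVec, mul_nonsing_inv _ hH.det_pos.ne'.isUnit, one_mulVec]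
  have := dotProduct_mulVec_le_of_mulVec_eq (u := G⁻¹ *ᵥ g) (y := H⁻¹ *ᵥ g)
    (isHermitian_iff_isSymm.1 hH.isHermitian)
    (fun v ↦ by simpa using hH.posSemidef.dotProduct_mulVec_nonneg v) hc hle (hGu.trans hHu.symm)
  rwa [hGu, hHu, dotProduct_comm, dotProduct_comm _ g] at this

lemma pow_le_det {A : Matrix (Fin n) (Fin n) ℝ} (hA : A.IsSymm) {μ : ℝ} (hμ : 0 < μ)
    (h : ∀ v, μ * (v ⬝ᵥ v) ≤ v ⬝ᵥ A *ᵥ v) : μ ^ n ≤ A.det := by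
  have hH : A.IsHermitian := by rwa [IsHermitian, conjTranspose_eq_transpose_of_trivial]
  rw [hH.det_eq_prod_eigenvalues]
  calc μ ^ n = ∏ _i : Fin n, μ := by simp
    _ ≤ _ := Finset.prod_le_prod (fun _ _ ↦ hμ.le) fun i _ ↦ ?_
  have h1 := h (hH.eigenvectorBasis i).ofLp
  have h2 : (hH.eigenvectorBasis i).ofLp ⬝ᵥ (hH.eigenvectorBasis i).ofLp = 1 := by
    have := hH.eigenvectorBasis.orthonormal.1 i
    rw [EuclideanSpace.norm_eq, Real.sqrt_eq_one] at this
    simpa [dotProduct, sq] using this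
  rw [h2, mul_one, hH.mulVec_eigenvectorBasis i, dotProduct_smul, h2] at h1
  simpa using h1

end QuadraticForms

section SR1

variable {n : ℕ} {A G : Matrix (Fin n) (Fin n) ℝ}

lemma isSymm_SR1 (A : Matrix (Fin n) (Fin n) ℝ) (hG : G.IsSymm) (u : Fin n → ℝ) :
    (SR1 A G u).IsSymm := by
  unfold SR1
  split_ifs
  · exact hG
  · refine hG.sub (IsSymm.smul ?_ _)
    rw [IsSymm, transpose_vecMulVec]

lemma SR1_eq (A G : Matrix (Fin n) (Fin n) ℝ) (u : Fin n → ℝ) :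
    SR1 A G u =
      G - (u ⬝ᵥ ((G - A) *ᵥ u))⁻¹ • vecMulVec ((G - A) *ᵥ u) ((G - A) *ᵥ u) := by
  unfold SR1
  split_ifs with h
  · simp [h]
  · rfl

lemma dotProduct_SR1_mulVec (A G : Matrix (Fin n) (Fin n) ℝ) (u v : Fin n → ℝ) :
    v ⬝ᵥ SR1 A G u *ᵥ v =
      v ⬝ᵥ G *ᵥ v - (u ⬝ᵥ ((G - A) *ᵥ u))⁻¹ * (v ⬝ᵥ (G - A) *ᵥ u) ^ 2 := by
  rw [SR1_eq, sub_mulVec, dotProduct_sub, smul_mulVec, dotProduct_smul, vecMulVec_mulVec,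
    op_smul_eq_smul, dotProduct_smul, dotProduct_comm ((G - A) *ᵥ u) v, smul_eq_mul, smul_eq_mul]
  ring

lemma dotProduct_SR1_mulVec_le (hR : (G - A).PosSemidef) (u v : Fin n → ℝ) :
    v ⬝ᵥ SR1 A G u *ᵥ v ≤ v ⬝ᵥ G *ᵥ v := by
  have : 0 ≤ u ⬝ᵥ (G - A) *ᵥ u := by simpa using hR.dotProduct_mulVec_nonneg u
  rw [dotProduct_SR1_mulVec]
  have := mul_nonneg (inv_nonneg.2 this) (sq_nonneg (v ⬝ᵥ (G - A) *ᵥ u))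
  linarith

lemma PosSemidef.mulVec_eq_zero_of_dotProduct {R : Matrix (Fin n) (Fin n) ℝ}
    (hR : R.PosSemidef) {u : Fin n → ℝ} (h : u ⬝ᵥ R *ᵥ u = 0) : R *ᵥ u = 0 :=
  (hR.dotProduct_mulVec_zero_iff u).1 (by simpa using h)

lemma le_dotProduct_SR1_mulVec (hR : (G - A).PosSemidef) (u v : Fin n → ℝ) :
    v ⬝ᵥ A *ᵥ v ≤ v ⬝ᵥ SR1 A G u *ᵥ v := by
  rw [dotProduct_SR1_mulVec]
  rcases eq_or_ne (u ⬝ᵥ (G - A) *ᵥ u) 0 with h0 | h0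
  · simpa [h0] using hR.dotProduct_mulVec_le v
  set ρ := u ⬝ᵥ (G - A) *ᵥ u with hρ
  have hsymm := (isHermitian_iff_isSymm.1 hR.isHermitian).dotProduct_mulVec_comm u v
  have h : 0 ≤ (v - (ρ⁻¹ * (v ⬝ᵥ (G - A) *ᵥ u)) • u) ⬝ᵥ
      (G - A) *ᵥ (v - (ρ⁻¹ * (v ⬝ᵥ (G - A) *ᵥ u)) • u) := by
    simpa using hR.dotProduct_mulVec_nonneg (v - (ρ⁻¹ * (v ⬝ᵥ (G - A) *ᵥ u)) • u)
  rw [mulVec_sub, mulVec_smul, sub_dotProduct, dotProduct_sub, dotProduct_sub, smul_dotProduct,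
    smul_dotProduct, dotProduct_smul, dotProduct_smul, hsymm, ← hρ] at h
  set q := v ⬝ᵥ (G - A) *ᵥ u
  have e : v ⬝ᵥ (G - A) *ᵥ v = v ⬝ᵥ G *ᵥ v - v ⬝ᵥ A *ᵥ v := by
    rw [sub_mulVec, dotProduct_sub]
  simp only [smul_eq_mul, e] at h
  rw [show ρ⁻¹ * q * ρ = q by field_simp] at h
  linear_combination h

lemma SR1_mulVec (hR : (G - A).PosSemidef) (u : Fin n → ℝ) : SR1 A G u *ᵥ u = A *ᵥ u := by
  rw [SR1_eq, sub_mulVec, smul_mulVec, vecMulVec_mulVec]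
  have : (u ⬝ᵥ (G - A) *ᵥ u)⁻¹ • ((u ⬝ᵥ (G - A) *ᵥ u) • ((G - A) *ᵥ u)) = (G - A) *ᵥ u := by
    rcases eq_or_ne (u ⬝ᵥ (G - A) *ᵥ u) 0 with h0 | h0
    · simp [hR.mulVec_eq_zero_of_dotProduct h0]
    · rw [smul_smul, inv_mul_cancel₀ h0, one_smul]
  simp only [dotProduct_comm ((G - A) *ᵥ u) u, op_smul_eq_smul]
  rw [this, sub_mulVec]
  abel

/-- The determinant drop of an SR1 update controls the residual in the inverse metric. -/
lemma det_SR1_mul (hR : (G - A).PosSemidef) (u : Fin n → ℝ) (h : (SR1 A G u).det ≠ 0) :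
    (SR1 A G u).det * (((G - A) *ᵥ u) ⬝ᵥ (SR1 A G u)⁻¹ *ᵥ ((G - A) *ᵥ u)) =
      (u ⬝ᵥ (G - A) *ᵥ u) * (G.det - (SR1 A G u).det) := by
  rcases eq_or_ne (u ⬝ᵥ (G - A) *ᵥ u) 0 with h0 | h0
  · simp [hR.mulVec_eq_zero_of_dotProduct h0]
  set v := (G - A) *ᵥ u with hv
  have hG : G = SR1 A G u +
      replicateCol Unit ((u ⬝ᵥ v)⁻¹ • v) * replicateRow Unit v := by
    rw [SR1_eq, ← vecMulVec_eq, smul_vecMulVec]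
    abel
  have hdet := det_add_replicateCol_mul_replicateRow (ι := Unit) h.isUnit ((u ⬝ᵥ v)⁻¹ • v) v
  rw [← hG] at hdet
  have : (1 + replicateRow Unit v * (SR1 A G u)⁻¹ * replicateCol Unit ((u ⬝ᵥ v)⁻¹ • v)).det =
      1 + (u ⬝ᵥ v)⁻¹ * (v ⬝ᵥ (SR1 A G u)⁻¹ *ᵥ v) := by
    rw [Matrix.mul_assoc, ← replicateCol_mulVec, det_unique, mulVec_smul]
    simp [mul_apply, dotProduct, Finset.mul_sum, mul_left_comm]
  rw [hdet, this]
  field_simp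
  ring

lemma det_SR1_le (hR : (G - A).PosSemidef) (u : Fin n → ℝ) (h : (SR1 A G u).PosDef) :
    (SR1 A G u).det ≤ G.det := by
  have hρ : 0 ≤ u ⬝ᵥ (G - A) *ᵥ u := by simpa using hR.dotProduct_mulVec_nonneg u
  rcases hρ.eq_or_lt with h0 | h0
  · rw [SR1, if_pos (hR.mulVec_eq_zero_of_dotProduct h0.symm)]
  · have hT : 0 ≤ ((G - A) *ᵥ u) ⬝ᵥ (SR1 A G u)⁻¹ *ᵥ ((G - A) *ᵥ u) := by
      simpa using h.posSemidef.inv.dotProduct_mulVec_nonneg ((G - A) *ᵥ u)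
    have := det_SR1_mul hR u h.det_pos.ne' ▸ mul_nonneg h.det_pos.le hT
    linarith [nonneg_of_mul_nonneg_right this h0]

/-- One step of the SR1 quasi-Newton residual: measured in the metric of the updated matrix, the
new residual is controlled by the scaling factor `c` and the determinant ratio. -/
lemma SR1_residual_le {c : ℝ} (hc : 1 ≤ c) (hA : A.PosSemidef) (hR : (c • G - A).PosSemidef)
    (u : Fin n → ℝ) (hS : (SR1 A (c • G) u).PosDef) :
    (A *ᵥ u - G *ᵥ u) ⬝ᵥ (SR1 A (c • G) u)⁻¹ *ᵥ (A *ᵥ u - G *ᵥ u) ≤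
      ((c - 1) ^ 2 + ((c • G).det / (SR1 A (c • G) u).det - 1)) * (u ⬝ᵥ G *ᵥ u) := by
  have hSu := SR1_mulVec hR u
  have hT := det_SR1_mul hR u hS.det_pos.ne'
  have hE := (one_le_div hS.det_pos).2 (det_SR1_le hR u hS)
  have ha : 0 ≤ u ⬝ᵥ A *ᵥ u := by simpa using hA.dotProduct_mulVec_nonneg u
  have hab := hR.dotProduct_mulVec_le u
  rw [sub_mulVec, smul_mulVec, ← hSu] at hT
  rw [smul_mulVec, dotProduct_smul, smul_eq_mul] at hab
  rw [← hSu] at ha hab ⊢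
  have hdet := hS.det_pos
  set S := SR1 A (c • G) u
  set w := G *ᵥ u
  have hinv : S⁻¹ *ᵥ S *ᵥ u = u := by
    rw [mulVec_mulVec, nonsing_inv_mul _ hdet.ne'.isUnit, one_mulVec]
  have hinv' : S *ᵥ S⁻¹ *ᵥ w = w := by
    rw [mulVec_mulVec, mul_nonsing_inv _ hdet.ne'.isUnit, one_mulVec]
  have hcross : (S *ᵥ u) ⬝ᵥ S⁻¹ *ᵥ w = u ⬝ᵥ w := by
    rw [dotProduct_comm,
      (isHermitian_iff_isSymm.1 hS.isHermitian).dotProduct_mulVec_comm, hinv']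
  have hcomm : (S *ᵥ u) ⬝ᵥ u = u ⬝ᵥ S *ᵥ u := dotProduct_comm _ _
  have hcomm' : w ⬝ᵥ u = u ⬝ᵥ w := dotProduct_comm _ _
  simp only [mulVec_sub, mulVec_smul, sub_dotProduct, dotProduct_sub, smul_dotProduct,
    dotProduct_smul, smul_eq_mul, hinv, hcross, hcomm, hcomm'] at hT ⊢
  set E := (c • G).det / S.det with hEdef
  have hEdet : (c • G).det = E * S.det := by rw [hEdef]; field_simp
  rw [hEdet] at hT
  set a := u ⬝ᵥ S *ᵥ u
  set b := u ⬝ᵥ w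
  set q := w ⬝ᵥ S⁻¹ *ᵥ w
  have hT' : c ^ 2 * q - 2 * c * b + a = (c * b - a) * (E - 1) := by
    apply mul_left_cancel₀ hdet.ne'
    linear_combination hT
  have hb : 0 ≤ b := nonneg_of_mul_nonneg_right (ha.trans hab) (by linarith)
  have key : c ^ 2 * (a - b - (b - q)) ≤ c ^ 2 * (((c - 1) ^ 2 + (E - 1)) * b) := by
    have h1 : 0 ≤ (c * b - a) * (c ^ 2 - 1) := mul_nonneg (by linarith) (by nlinarith)
    have h2 : 0 ≤ a * (E - 1) := mul_nonneg ha (by linarith)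
    have h3 : 0 ≤ (c ^ 2 - c) * (((c - 1) ^ 2 + (E - 1)) * b) :=
      mul_nonneg (by nlinarith) (mul_nonneg (by nlinarith) hb)
    nlinarith
  exact le_of_mul_le_mul_left key (by positivity)

/-- One step of linear decrease of the residual in the metric of `A⁻¹`. -/
lemma quasiNewton_residual_le {c K : ℝ} (hc : c ≤ 2) (hK : 0 < K) (hA : A.PosDef)
    (hG : G.PosDef) (hAG : ∀ v, v ⬝ᵥ A *ᵥ v ≤ c * (v ⬝ᵥ G *ᵥ v))
    (hGA : ∀ v, v ⬝ᵥ G *ᵥ v ≤ K * (v ⬝ᵥ A *ᵥ v)) (u : Fin n → ℝ) :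
    (A *ᵥ u - G *ᵥ u) ⬝ᵥ A⁻¹ *ᵥ (A *ᵥ u - G *ᵥ u) ≤
      (1 - (2 - c) / K) * ((G *ᵥ u) ⬝ᵥ A⁻¹ *ᵥ (G *ᵥ u)) := by
  have hdet := hA.det_pos
  set w := G *ᵥ u with hw
  have hinv : A⁻¹ *ᵥ A *ᵥ u = u := by
    rw [mulVec_mulVec, nonsing_inv_mul _ hdet.ne'.isUnit, one_mulVec]
  have hinv' : A *ᵥ A⁻¹ *ᵥ w = w := by
    rw [mulVec_mulVec, mul_nonsing_inv _ hdet.ne'.isUnit, one_mulVec]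
  have hcross : (A *ᵥ u) ⬝ᵥ A⁻¹ *ᵥ w = u ⬝ᵥ w := by
    rw [dotProduct_comm,
      (isHermitian_iff_isSymm.1 hA.isHermitian).dotProduct_mulVec_comm, hinv']
  have hcomm : (A *ᵥ u) ⬝ᵥ u = u ⬝ᵥ A *ᵥ u := dotProduct_comm _ _
  have hcomm' : w ⬝ᵥ u = u ⬝ᵥ w := dotProduct_comm _ _
  have hle := dotProduct_mulVec_le_of_mulVec_eq (isHermitian_iff_isSymm.1 hG.isHermitian)
    (fun v ↦ by simpa using hG.posSemidef.dotProduct_mulVec_nonneg v) hK hGA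
    (hinv'.trans hw)
  rw [hinv', dotProduct_comm] at hle
  simp only [mulVec_sub, sub_dotProduct, dotProduct_sub, hinv, hcross, hcomm, hcomm']
  have h1 := hAG u
  have h2 : (2 - c) / K * (w ⬝ᵥ A⁻¹ *ᵥ w) ≤ (2 - c) * (u ⬝ᵥ w) := by
    rw [div_mul_eq_mul_div, div_le_iff₀ hK, mul_assoc, mul_comm _ K]
    exact mul_le_mul_of_nonneg_left hle (by linarith)
  linarith

end SR1

end Matrix

section Hessian

open intervalIntegral

variable {n : ℕ} {f : (Fin n → ℝ) → ℝ}

lemma hess_apply (f : (Fin n → ℝ) → ℝ) (x : Fin n → ℝ) (i j : Fin n) :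
    hess f x i j = fderiv ℝ (fderiv ℝ f) x (Pi.single i 1) (Pi.single j 1) := by
  simp [hess, iteratedFDeriv_two_apply]

lemma continuous_hess (hf : ContDiff ℝ 2 f) : Continuous (hess f) := by
  have h1 : ContDiff ℝ 1 (fderiv ℝ f) := hf.fderiv_right (by norm_num)
  have h2 : Continuous (fderiv ℝ (fderiv ℝ f)) := h1.continuous_fderiv (by norm_num)
  refine continuous_matrix fun i j ↦ ?_
  simp only [hess_apply]
  fun_prop

lemma vecMul_hess (f : (Fin n → ℝ) → ℝ) (x u : Fin n → ℝ) (i : Fin n) :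
    (u ᵥ* hess f x) i = fderiv ℝ (fderiv ℝ f) x u (Pi.single i 1) := by
  have hu : u = ∑ j, u j • Pi.single j (1 : ℝ) := by
    ext j; simp [Finset.sum_apply, Pi.single_apply]
  conv_rhs => rw [hu]
  simp [vecMul, dotProduct, hess_apply]

lemma continuous_dotProduct_hess (hf : ContDiff ℝ 2 f) (x u v w : Fin n → ℝ) :
    Continuous fun t : ℝ ↦ v ⬝ᵥ hess f (x + t • u) *ᵥ w := by
  have := (continuous_hess hf).comp (show Continuous fun t : ℝ ↦ x + t • u by fun_prop)
  exact continuous_const.dotProduct (this.matrix_mulVec continuous_const)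

lemma dotProduct_Jmat_mulVec (hf : ContDiff ℝ 2 f) (x : ℕ → Fin n → ℝ) (k : ℕ)
    (v w : Fin n → ℝ) :
    v ⬝ᵥ Jmat f x k *ᵥ w =
      ∫ t in (0 : ℝ)..1, v ⬝ᵥ hess f (x k + t • (x (k + 1) - x k)) *ᵥ w := by
  have hc (i j : Fin n) :
      Continuous fun t : ℝ ↦ hess f (x k + t • (x (k + 1) - x k)) i j :=
    ((continuous_hess hf).matrix_elem i j).comp (by fun_prop)
  simp only [dotProduct, mulVec, Jmat, of_apply]
  rw [integral_finsetSum fun i _ ↦ Continuous.intervalIntegrable (by fun_prop) _ _]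
  refine Finset.sum_congr rfl fun i _ ↦ ?_
  rw [integral_const_mul,
    integral_finsetSum fun j _ ↦ Continuous.intervalIntegrable (by fun_prop) _ _]
  simp only [integral_mul_const]

lemma isSymm_Jmat (hsymm : ∀ y, (hess f y).IsSymm) (x : ℕ → Fin n → ℝ) (k : ℕ) :
    (Jmat f x k).IsSymm := by
  ext i j
  simp only [Jmat, transpose_apply, of_apply, (hsymm _).apply]

/-- The averaged Hessian maps the step to the difference of the gradients. -/
lemma Jmat_mulVec_sub (hf : ContDiff ℝ 2 f) (hsymm : ∀ y, (hess f y).IsSymm)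
    (x : ℕ → Fin n → ℝ) (k : ℕ) :
    Jmat f x k *ᵥ (x (k + 1) - x k) = grad f (x (k + 1)) - grad f (x k) := by
  have h1 : Differentiable ℝ (fderiv ℝ f) :=
    (hf.fderiv_right (m := 1) (by norm_num)).differentiable (by norm_num)
  ext i
  set u := x (k + 1) - x k with hu
  have hJ := dotProduct_Jmat_mulVec hf x k (Pi.single i 1) u
  simp only [single_one_dotProduct] at hJ
  have hderiv (t : ℝ) : HasDerivAt (fun t : ℝ ↦ fderiv ℝ f (x k + t • u) (Pi.single i 1))
      ((hess f (x k + t • u) *ᵥ u) i) t := by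
    have hl : HasDerivAt (fun t : ℝ ↦ x k + t • u) u t := by
      simpa using ((hasDerivAt_id t).smul_const u).const_add (x k)
    rw [← (hsymm (x k + t • u)).eq, mulVec_transpose, vecMul_hess]
    exact (ContinuousLinearMap.apply ℝ ℝ (Pi.single i (1 : ℝ))).hasFDerivAt.comp_hasDerivAt t
      ((h1 (x k + t • u)).hasFDerivAt.comp_hasDerivAt t hl)
  have hint := continuous_dotProduct_hess hf (x k) u (Pi.single i 1) u
  simp only [single_one_dotProduct] at hint
  rw [hJ, integral_eq_sub_of_hasDerivAt (fun t _ ↦ hderiv t) (hint.intervalIntegrable _ _)]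
  simp [grad, hu]

end Hessian

section Averages

open intervalIntegral

variable {φ : ℝ → ℝ} {a : ℝ}

private lemma average_le_left (hφ : Continuous φ)
    (h : ∀ s t w, φ t - φ s ≤ a * |t - s| * φ w) :
    ∫ t in (0 : ℝ)..1, φ t ≤ (1 + a / 2) * φ 0 := by
  have : ∫ t in (0 : ℝ)..1, φ t ≤ ∫ t in (0 : ℝ)..1, (φ 0 + t * (a * φ 0)) := by
    refine integral_mono_on zero_le_one (hφ.intervalIntegrable _ _)
      (Continuous.intervalIntegrable (by fun_prop) _ _) fun t ht ↦ ?_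
    have := h 0 t 0
    rw [sub_zero, abs_of_nonneg ht.1] at this
    linarith
  refine this.trans_eq ?_
  rw [integral_add (by simp) (Continuous.intervalIntegrable (by fun_prop) _ _),
    integral_mul_const]
  simp
  ring

private lemma left_le_average (hφ : Continuous φ)
    (h : ∀ s t w, φ t - φ s ≤ a * |t - s| * φ w) :
    φ 0 ≤ (1 + a / 2) * ∫ t in (0 : ℝ)..1, φ t := by
  have key (w : ℝ) : φ 0 - ∫ t in (0 : ℝ)..1, φ t ≤ a / 2 * φ w := by
    have : ∫ t in (0 : ℝ)..1, (φ 0 - t * (a * φ w)) ≤ ∫ t in (0 : ℝ)..1, φ t := by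
      refine integral_mono_on zero_le_one
        (Continuous.intervalIntegrable (by fun_prop) _ _) (hφ.intervalIntegrable _ _) fun t ht ↦ ?_
      have := h t 0 w
      rw [zero_sub, abs_neg, abs_of_nonneg ht.1] at this
      linarith
    rw [integral_sub (by simp) (Continuous.intervalIntegrable (by fun_prop) _ _),
      integral_mul_const] at this
    simp at this
    linarith
  have := integral_mono_on (μ := MeasureTheory.volume) zero_le_one (by simp)
    (Continuous.intervalIntegrable (u := fun w ↦ a / 2 * φ w) (by fun_prop) _ _)
    fun w (_ : w ∈ Set.Icc (0 : ℝ) 1) ↦ key w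
  rw [integral_const_mul] at this
  simp at this
  linarith

private lemma reflect_hyp (h : ∀ s t w, φ t - φ s ≤ a * |t - s| * φ w) (s t w : ℝ) :
    φ (1 - t) - φ (1 - s) ≤ a * |t - s| * φ (1 - w) := by
  have := h (1 - s) (1 - t) (1 - w)
  rwa [sub_sub_sub_cancel_left, abs_sub_comm] at this

private lemma average_le_right (hφ : Continuous φ)
    (h : ∀ s t w, φ t - φ s ≤ a * |t - s| * φ w) :
    ∫ t in (0 : ℝ)..1, φ t ≤ (1 + a / 2) * φ 1 := by
  simpa using average_le_left (φ := fun t ↦ φ (1 - t)) (by fun_prop) (reflect_hyp h)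

private lemma right_le_average (hφ : Continuous φ)
    (h : ∀ s t w, φ t - φ s ≤ a * |t - s| * φ w) :
    φ 1 ≤ (1 + a / 2) * ∫ t in (0 : ℝ)..1, φ t := by
  simpa using left_le_average (φ := fun t ↦ φ (1 - t)) (by fun_prop) (reflect_hyp h)

end Averages

section SelfConcordance

variable {n : ℕ} {f : (Fin n → ℝ) → ℝ} {M : ℝ}

lemma StrongSelfConcordant.segment_le (hssc : StrongSelfConcordant f M) (x u v : Fin n → ℝ)
    (s t w : ℝ) :
    v ⬝ᵥ hess f (x + t • u) *ᵥ v - v ⬝ᵥ hess f (x + s • u) *ᵥ v ≤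
      M * znorm f x u * |t - s| * (v ⬝ᵥ hess f (x + w • u) *ᵥ v) := by
  have h := (hssc (x + s • u) (x + t • u) x (x + w • u)).dotProduct_mulVec_le v
  have hz : znorm f x (x + t • u - (x + s • u)) = |t - s| * znorm f x u := by
    rw [add_sub_add_left_eq_sub, ← sub_smul, znorm, znorm, mulVec_smul, smul_dotProduct,
      dotProduct_smul, smul_eq_mul, smul_eq_mul, ← mul_assoc, ← sq,
      Real.sqrt_mul (sq_nonneg _), Real.sqrt_sq_eq_abs]
  rw [hz, sub_mulVec, dotProduct_sub, smul_mulVec, dotProduct_smul, smul_eq_mul] at h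
  linarith

lemma StrongSelfConcordant.Jmat_le_hess (hssc : StrongSelfConcordant f M)
    (hf : ContDiff ℝ 2 f) (x : ℕ → Fin n → ℝ) (k : ℕ) (v : Fin n → ℝ) :
    v ⬝ᵥ Jmat f x k *ᵥ v ≤
      (1 + M * znorm f (x k) (x (k + 1) - x k) / 2) * (v ⬝ᵥ hess f (x k) *ᵥ v) := by
  rw [dotProduct_Jmat_mulVec hf]
  simpa using average_le_left (continuous_dotProduct_hess hf (x k) (x (k + 1) - x k) v v)
    (hssc.segment_le _ _ v)

lemma StrongSelfConcordant.hess_le_Jmat (hssc : StrongSelfConcordant f M)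
    (hf : ContDiff ℝ 2 f) (x : ℕ → Fin n → ℝ) (k : ℕ) (v : Fin n → ℝ) :
    v ⬝ᵥ hess f (x k) *ᵥ v ≤
      (1 + M * znorm f (x k) (x (k + 1) - x k) / 2) * (v ⬝ᵥ Jmat f x k *ᵥ v) := by
  rw [dotProduct_Jmat_mulVec hf]
  simpa using left_le_average (continuous_dotProduct_hess hf (x k) (x (k + 1) - x k) v v)
    (hssc.segment_le _ _ v)

lemma StrongSelfConcordant.Jmat_le_hess_succ (hssc : StrongSelfConcordant f M)
    (hf : ContDiff ℝ 2 f) (x : ℕ → Fin n → ℝ) (k : ℕ) (v : Fin n → ℝ) :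
    v ⬝ᵥ Jmat f x k *ᵥ v ≤
      (1 + M * znorm f (x k) (x (k + 1) - x k) / 2) * (v ⬝ᵥ hess f (x (k + 1)) *ᵥ v) := by
  rw [dotProduct_Jmat_mulVec hf]
  simpa using average_le_right (continuous_dotProduct_hess hf (x k) (x (k + 1) - x k) v v)
    (hssc.segment_le _ _ v)

lemma StrongSelfConcordant.hess_succ_le_Jmat (hssc : StrongSelfConcordant f M)
    (hf : ContDiff ℝ 2 f) (x : ℕ → Fin n → ℝ) (k : ℕ) (v : Fin n → ℝ) :
    v ⬝ᵥ hess f (x (k + 1)) *ᵥ v ≤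
      (1 + M * znorm f (x k) (x (k + 1) - x k) / 2) * (v ⬝ᵥ Jmat f x k *ᵥ v) := by
  rw [dotProduct_Jmat_mulVec hf]
  simpa using right_le_average (continuous_dotProduct_hess hf (x k) (x (k + 1) - x k) v v)
    (hssc.segment_le _ _ v)

end SelfConcordance

lemma mul_le_dotProduct_Jmat {n : ℕ} {f : (Fin n → ℝ) → ℝ} {μ : ℝ} (hf : ContDiff ℝ 2 f)
    (h : ∀ y v : Fin n → ℝ, μ * (v ⬝ᵥ v) ≤ v ⬝ᵥ hess f y *ᵥ v) (x : ℕ → Fin n → ℝ) (k : ℕ)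
    (v : Fin n → ℝ) : μ * (v ⬝ᵥ v) ≤ v ⬝ᵥ Jmat f x k *ᵥ v := by
  rw [dotProduct_Jmat_mulVec hf]
  have := intervalIntegral.integral_mono_on (μ := MeasureTheory.volume) zero_le_one
    (intervalIntegrable_const (c := μ * (v ⬝ᵥ v)))
    ((continuous_dotProduct_hess hf (x k) (x (k + 1) - x k) v v).intervalIntegrable _ _)
    fun t _ ↦ h _ v
  simpa using this

/-- The SR1 quasi-Newton iteration with correction strategy, for a strongly self-concordant
function whose Hessian lies between `μ • 1` and `L • 1`. -/
structure IsCorrectedSR1 {n : ℕ} (f : (Fin n → ℝ) → ℝ) (μ L M : ℝ) (x : ℕ → Fin n → ℝ)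
    (G : ℕ → Matrix (Fin n) (Fin n) ℝ) (r rm : ℕ → ℝ) : Prop where
  contDiff : ContDiff ℝ 2 f
  mu_pos : 0 < μ
  mu_le : μ ≤ L
  M_nonneg : 0 ≤ M
  low : ∀ y : Fin n → ℝ, (hess f y - μ • (1 : Matrix (Fin n) (Fin n) ℝ)).PosSemidef
  up : ∀ y : Fin n → ℝ, (L • (1 : Matrix (Fin n) (Fin n) ℝ) - hess f y).PosSemidef
  ssc : StrongSelfConcordant f M
  G_zero : G 0 = L • (1 : Matrix (Fin n) (Fin n) ℝ)
  rm_zero : rm 0 = 0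
  rm_succ : ∀ k, rm (k + 1) = r k
  x_succ : ∀ k, x (k + 1) = x k - (G k)⁻¹ *ᵥ grad f (x k)
  r_eq : ∀ k, r k = znorm f (x k) (x (k + 1) - x k)
  G_succ : ∀ k, G (k + 1) =
    SR1 (Jmat f x k) (((1 + M * rm k / 2) * (1 + M * r k / 2)) • G k) (x (k + 1) - x k)

namespace IsCorrectedSR1

variable {n : ℕ} {f : (Fin n → ℝ) → ℝ} {μ L M : ℝ} {x : ℕ → Fin n → ℝ}
  {G : ℕ → Matrix (Fin n) (Fin n) ℝ} {r rm : ℕ → ℝ}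

lemma L_pos (h : IsCorrectedSR1 f μ L M x G r rm) : 0 < L := h.mu_pos.trans_le h.mu_le

lemma hess_isSymm (h : IsCorrectedSR1 f μ L M x G r rm) (y : Fin n → ℝ) :
    (hess f y).IsSymm := by
  have h1 := isHermitian_iff_isSymm.1 (h.low y).isHermitian
  have h2 := h1.add ((isSymm_one (n := Fin n) (α := ℝ)).smul μ)
  rwa [sub_add_cancel] at h2

lemma le_hess (h : IsCorrectedSR1 f μ L M x G r rm) (y v : Fin n → ℝ) :
    μ * (v ⬝ᵥ v) ≤ v ⬝ᵥ hess f y *ᵥ v := by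
  simpa [smul_mulVec] using (h.low y).dotProduct_mulVec_le v

lemma hess_le (h : IsCorrectedSR1 f μ L M x G r rm) (y v : Fin n → ℝ) :
    v ⬝ᵥ hess f y *ᵥ v ≤ L * (v ⬝ᵥ v) := by
  simpa [smul_mulVec] using (h.up y).dotProduct_mulVec_le v

lemma hess_posDef (h : IsCorrectedSR1 f μ L M x G r rm) (y : Fin n → ℝ) : (hess f y).PosDef :=
  posDef_of_forall_le (h.hess_isSymm y) h.mu_pos (h.le_hess y)

lemma Jmat_isSymm (h : IsCorrectedSR1 f μ L M x G r rm) (k : ℕ) : (Jmat f x k).IsSymm :=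
  isSymm_Jmat h.hess_isSymm x k

lemma le_Jmat (h : IsCorrectedSR1 f μ L M x G r rm) (k : ℕ) (v : Fin n → ℝ) :
    μ * (v ⬝ᵥ v) ≤ v ⬝ᵥ Jmat f x k *ᵥ v :=
  mul_le_dotProduct_Jmat h.contDiff h.le_hess x k v

lemma Jmat_posDef (h : IsCorrectedSR1 f μ L M x G r rm) (k : ℕ) : (Jmat f x k).PosDef :=
  posDef_of_forall_le (h.Jmat_isSymm k) h.mu_pos (h.le_Jmat k)

lemma M_mul_r_nonneg (h : IsCorrectedSR1 f μ L M x G r rm) (k : ℕ) : 0 ≤ M * r k := by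
  rw [h.r_eq]
  exact mul_nonneg h.M_nonneg (Real.sqrt_nonneg _)

lemma M_mul_rm_nonneg (h : IsCorrectedSR1 f μ L M x G r rm) (k : ℕ) : 0 ≤ M * rm k := by
  cases k with
  | zero => simp [h.rm_zero]
  | succ k => rw [h.rm_succ]; exact h.M_mul_r_nonneg k

lemma one_le_corr (h : IsCorrectedSR1 f μ L M x G r rm) (k : ℕ) :
    1 ≤ (1 + M * rm k / 2) * (1 + M * r k / 2) :=
  one_le_mul_of_one_le_of_one_le (by linarith [h.M_mul_rm_nonneg k])
    (by linarith [h.M_mul_r_nonneg k])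

lemma Jmat_le_corr_of_hess_le (h : IsCorrectedSR1 f μ L M x G r rm) {k : ℕ}
    (hG : ∀ v, v ⬝ᵥ hess f (x k) *ᵥ v ≤ (1 + M * rm k / 2) * (v ⬝ᵥ G k *ᵥ v)) (v : Fin n → ℝ) :
    v ⬝ᵥ Jmat f x k *ᵥ v ≤
      (1 + M * rm k / 2) * (1 + M * r k / 2) * (v ⬝ᵥ G k *ᵥ v) := by
  have hr := h.M_mul_r_nonneg k
  calc v ⬝ᵥ Jmat f x k *ᵥ v ≤ (1 + M * r k / 2) * (v ⬝ᵥ hess f (x k) *ᵥ v) := by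
        rw [h.r_eq]; exact h.ssc.Jmat_le_hess h.contDiff x k v
    _ ≤ (1 + M * r k / 2) * ((1 + M * rm k / 2) * (v ⬝ᵥ G k *ᵥ v)) := by gcongr; exact hG v
    _ = _ := by ring

lemma corr_sub_Jmat_posSemidef (h : IsCorrectedSR1 f μ L M x G r rm) {k : ℕ} (hS : (G k).IsSymm)
    (hG : ∀ v, v ⬝ᵥ hess f (x k) *ᵥ v ≤ (1 + M * rm k / 2) * (v ⬝ᵥ G k *ᵥ v)) :
    (((1 + M * rm k / 2) * (1 + M * r k / 2)) • G k - Jmat f x k).PosSemidef :=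
  posSemidef_sub_of_forall_le (h.Jmat_isSymm k) (hS.smul _) fun v ↦ by
    simpa [smul_mulVec] using h.Jmat_le_corr_of_hess_le hG v

lemma G_isSymm_and_bounds (h : IsCorrectedSR1 f μ L M x G r rm) (k : ℕ) :
    (G k).IsSymm ∧ (∀ v, μ * (v ⬝ᵥ v) ≤ v ⬝ᵥ G k *ᵥ v) ∧
      (∀ v, v ⬝ᵥ hess f (x k) *ᵥ v ≤ (1 + M * rm k / 2) * (v ⬝ᵥ G k *ᵥ v)) ∧
      ∀ v, v ⬝ᵥ G k *ᵥ v ≤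
        (∏ i ∈ Finset.range k, (1 + M * rm i / 2) * (1 + M * r i / 2)) * (L * (v ⬝ᵥ v)) := by
  induction k with
  | zero =>
    refine ⟨?_, fun v ↦ ?_, fun v ↦ ?_, fun v ↦ ?_⟩
    · rw [h.G_zero]; exact isSymm_one.smul _
    · rw [h.G_zero]
      have : 0 ≤ v ⬝ᵥ v := dotProduct_star_self_nonneg v
      simpa [smul_mulVec] using mul_le_mul_of_nonneg_right h.mu_le this
    · simpa [h.G_zero, h.rm_zero, smul_mulVec] using h.hess_le (x 0) v
    · simp [h.G_zero, smul_mulVec]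
  | succ k ih =>
    obtain ⟨hS, -, hH, hP⟩ := ih
    have hR := h.corr_sub_Jmat_posSemidef hS hH
    have hle := le_dotProduct_SR1_mulVec hR (x (k + 1) - x k)
    rw [h.G_succ k]
    refine ⟨isSymm_SR1 _ (hS.smul _) _, fun v ↦ (h.le_Jmat k v).trans (hle v), fun v ↦ ?_,
      fun v ↦ (dotProduct_SR1_mulVec_le hR _ v).trans ?_⟩
    · have hr := h.M_mul_r_nonneg k
      rw [h.rm_succ]
      calc _ ≤ (1 + M * r k / 2) * (v ⬝ᵥ Jmat f x k *ᵥ v) := by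
            rw [h.r_eq]; exact h.ssc.hess_succ_le_Jmat h.contDiff x k v
        _ ≤ _ := by gcongr; exact hle v
    · rw [Finset.prod_range_succ, smul_mulVec, dotProduct_smul, smul_eq_mul,
        mul_comm (Finset.prod _ _), mul_assoc _ (Finset.prod _ _)]
      exact mul_le_mul_of_nonneg_left (hP v) (zero_le_one.trans (h.one_le_corr k))

lemma G_posDef (h : IsCorrectedSR1 f μ L M x G r rm) (k : ℕ) : (G k).PosDef :=
  posDef_of_forall_le (h.G_isSymm_and_bounds k).1 h.mu_pos (h.G_isSymm_and_bounds k).2.1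

lemma hess_le_G (h : IsCorrectedSR1 f μ L M x G r rm) (k : ℕ) (v : Fin n → ℝ) :
    v ⬝ᵥ hess f (x k) *ᵥ v ≤ (1 + M * rm k / 2) * (v ⬝ᵥ G k *ᵥ v) :=
  (h.G_isSymm_and_bounds k).2.2.1 v

lemma corr_smul_sub_Jmat_posSemidef (h : IsCorrectedSR1 f μ L M x G r rm) (k : ℕ) :
    (((1 + M * rm k / 2) * (1 + M * r k / 2)) • G k - Jmat f x k).PosSemidef :=
  h.corr_sub_Jmat_posSemidef (h.G_isSymm_and_bounds k).1 (h.hess_le_G k)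

lemma prod_pos (h : IsCorrectedSR1 f μ L M x G r rm) (k : ℕ) :
    0 < ∏ i ∈ Finset.range k, (1 + M * rm i / 2) * (1 + M * r i / 2) :=
  Finset.prod_pos fun i _ ↦ zero_lt_one.trans_le (h.one_le_corr i)

lemma G_le_of_le (h : IsCorrectedSR1 f μ L M x G r rm) (k : ℕ) {A : Matrix (Fin n) (Fin n) ℝ}
    {v : Fin n → ℝ} (hA : μ * (v ⬝ᵥ v) ≤ v ⬝ᵥ A *ᵥ v) :
    v ⬝ᵥ G k *ᵥ v ≤ (∏ i ∈ Finset.range k, (1 + M * rm i / 2) * (1 + M * r i / 2)) * (L / μ) *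
      (v ⬝ᵥ A *ᵥ v) := by
  refine ((h.G_isSymm_and_bounds k).2.2.2 v).trans ?_
  rw [mul_assoc]
  refine mul_le_mul_of_nonneg_left ?_ (h.prod_pos k).le
  calc L * (v ⬝ᵥ v) = L / μ * (μ * (v ⬝ᵥ v)) := by have := h.mu_pos; field_simp
    _ ≤ _ := mul_le_mul_of_nonneg_left hA (div_pos h.L_pos h.mu_pos).le

lemma mul_inv_mulVec (h : IsCorrectedSR1 f μ L M x G r rm) (k : ℕ) (v : Fin n → ℝ) :
    G k *ᵥ (G k)⁻¹ *ᵥ v = v := by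
  rw [mulVec_mulVec, mul_nonsing_inv _ (h.G_posDef k).det_pos.ne'.isUnit, one_mulVec]

lemma G_mulVec_step (h : IsCorrectedSR1 f μ L M x G r rm) (k : ℕ) :
    G k *ᵥ (x (k + 1) - x k) = -grad f (x k) := by
  rw [h.x_succ, sub_sub_cancel_left, mulVec_neg, h.mul_inv_mulVec]

lemma grad_succ (h : IsCorrectedSR1 f μ L M x G r rm) (k : ℕ) :
    grad f (x (k + 1)) =
      Jmat f x k *ᵥ (x (k + 1) - x k) - G k *ᵥ (x (k + 1) - x k) := by
  rw [Jmat_mulVec_sub h.contDiff h.hess_isSymm, h.G_mulVec_step]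
  abel

lemma step_dotProduct (h : IsCorrectedSR1 f μ L M x G r rm) (k : ℕ) :
    (x (k + 1) - x k) ⬝ᵥ G k *ᵥ (x (k + 1) - x k) = grad f (x k) ⬝ᵥ (G k)⁻¹ *ᵥ grad f (x k) := by
  rw [h.G_mulVec_step, h.x_succ, sub_sub_cancel_left, neg_dotProduct_neg, dotProduct_comm]

lemma lamG_sq (h : IsCorrectedSR1 f μ L M x G r rm) (y : Fin n → ℝ) :
    lamG f y ^ 2 = grad f y ⬝ᵥ (hess f y)⁻¹ *ᵥ grad f y :=
  Real.sq_sqrt (by simpa using (h.hess_posDef y).inv.posSemidef.dotProduct_mulVec_nonneg _)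

lemma grad_G_inv_nonneg (h : IsCorrectedSR1 f μ L M x G r rm) (k : ℕ) :
    0 ≤ grad f (x k) ⬝ᵥ (G k)⁻¹ *ᵥ grad f (x k) := by
  simpa using (h.G_posDef k).inv.posSemidef.dotProduct_mulVec_nonneg (grad f (x k))

lemma grad_G_inv_le (h : IsCorrectedSR1 f μ L M x G r rm) (k : ℕ) :
    grad f (x k) ⬝ᵥ (G k)⁻¹ *ᵥ grad f (x k) ≤ (1 + M * rm k / 2) * lamG f (x k) ^ 2 := by
  rw [h.lamG_sq]
  exact dotProduct_inv_mulVec_le (h.G_posDef k) (h.hess_posDef _)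
    (by linarith [h.M_mul_rm_nonneg k]) (h.hess_le_G k) _

lemma lamG_sq_le (h : IsCorrectedSR1 f μ L M x G r rm) (k : ℕ) :
    lamG f (x k) ^ 2 ≤
      (∏ i ∈ Finset.range k, (1 + M * rm i / 2) * (1 + M * r i / 2)) * (L / μ) *
        (grad f (x k) ⬝ᵥ (G k)⁻¹ *ᵥ grad f (x k)) := by
  rw [h.lamG_sq]
  exact dotProduct_inv_mulVec_le (h.hess_posDef _) (h.G_posDef k)
    (mul_pos (h.prod_pos k) (div_pos h.L_pos h.mu_pos)) (fun v ↦ h.G_le_of_le k (h.le_hess _ v)) _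

lemma r_le (h : IsCorrectedSR1 f μ L M x G r rm) (k : ℕ) :
    r k ≤ (1 + M * rm k / 2) * lamG f (x k) := by
  have hrm := h.M_mul_rm_nonneg k
  rw [h.r_eq]
  refine Real.sqrt_le_iff.2 ⟨mul_nonneg (by linarith) (Real.sqrt_nonneg _), ?_⟩
  calc _ ≤ (1 + M * rm k / 2) * (grad f (x k) ⬝ᵥ (G k)⁻¹ *ᵥ grad f (x k)) := by
        rw [← h.step_dotProduct]; exact h.hess_le_G k _
    _ ≤ (1 + M * rm k / 2) * ((1 + M * rm k / 2) * lamG f (x k) ^ 2) := by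
        gcongr; exact h.grad_G_inv_le k
    _ = _ := by ring

lemma lamG_succ_sq_le (h : IsCorrectedSR1 f μ L M x G r rm) (k : ℕ)
    (hc : (1 + M * rm k / 2) * (1 + M * r k / 2) ≤ 2)
    (hq : 0 ≤ 1 - (2 - (1 + M * rm k / 2) * (1 + M * r k / 2)) /
      ((∏ i ∈ Finset.range k, (1 + M * rm i / 2) * (1 + M * r i / 2)) * (L / μ))) :
    lamG f (x (k + 1)) ^ 2 ≤ (1 + M * r k / 2) ^ 2 *
      (1 - (2 - (1 + M * rm k / 2) * (1 + M * r k / 2)) /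
        ((∏ i ∈ Finset.range k, (1 + M * rm i / 2) * (1 + M * r i / 2)) * (L / μ))) *
      lamG f (x k) ^ 2 := by
  have hr := h.M_mul_r_nonneg k
  have hr' : 0 < 1 + M * r k / 2 := by linarith
  rw [h.lamG_sq, h.lamG_sq]
  have h1 := dotProduct_inv_mulVec_le (h.hess_posDef (x (k + 1))) (h.Jmat_posDef k) hr'
    (fun v ↦ by rw [h.r_eq]; exact h.ssc.Jmat_le_hess_succ h.contDiff x k v)
    (grad f (x (k + 1)))
  have h2 := quasiNewton_residual_le hc (mul_pos (h.prod_pos k) (div_pos h.L_pos h.mu_pos))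
    (h.Jmat_posDef k) (h.G_posDef k) (h.Jmat_le_corr_of_hess_le (h.hess_le_G k))
    (fun v ↦ h.G_le_of_le k (h.le_Jmat k v)) (x (k + 1) - x k)
  rw [← h.grad_succ, h.G_mulVec_step] at h2
  simp only [mulVec_neg, neg_dotProduct_neg] at h2
  have h3 := dotProduct_inv_mulVec_le (h.Jmat_posDef k) (h.hess_posDef (x k)) hr'
    (fun v ↦ by rw [h.r_eq]; exact h.ssc.hess_le_Jmat h.contDiff x k v) (grad f (x k))
  refine (h1.trans (mul_le_mul_of_nonneg_left
    (h2.trans (mul_le_mul_of_nonneg_left h3 hq)) hr'.le)).trans_eq ?_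
  ring

lemma grad_G_inv_succ_le (h : IsCorrectedSR1 f μ L M x G r rm) (k : ℕ) :
    grad f (x (k + 1)) ⬝ᵥ (G (k + 1))⁻¹ *ᵥ grad f (x (k + 1)) ≤
      (((1 + M * rm k / 2) * (1 + M * r k / 2) - 1) ^ 2 +
        (((1 + M * rm k / 2) * (1 + M * r k / 2)) ^ n * (G k).det / (G (k + 1)).det - 1)) *
      (grad f (x k) ⬝ᵥ (G k)⁻¹ *ᵥ grad f (x k)) := by
  have hS := h.G_posDef (k + 1)
  rw [h.G_succ] at hS
  have := SR1_residual_le (h.one_le_corr k) (h.Jmat_posDef k).posSemidef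
    (h.corr_smul_sub_Jmat_posSemidef k) (x (k + 1) - x k) hS
  rwa [← h.grad_succ, ← h.G_succ, det_smul, Fintype.card_fin, h.step_dotProduct] at this

lemma det_succ_le (h : IsCorrectedSR1 f μ L M x G r rm) (k : ℕ) :
    (G (k + 1)).det ≤ ((1 + M * rm k / 2) * (1 + M * r k / 2)) ^ n * (G k).det := by
  have hS := h.G_posDef (k + 1)
  rw [h.G_succ] at hS
  have := det_SR1_le (h.corr_smul_sub_Jmat_posSemidef k) (x (k + 1) - x k) hS
  rwa [← h.G_succ, det_smul, Fintype.card_fin] at this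

lemma pow_le_det_G (h : IsCorrectedSR1 f μ L M x G r rm) (k : ℕ) : μ ^ n ≤ (G k).det :=
  pow_le_det (h.G_isSymm_and_bounds k).1 h.mu_pos (h.G_isSymm_and_bounds k).2.1

lemma det_G_zero (h : IsCorrectedSR1 f μ L M x G r rm) : (G 0).det = L ^ n := by
  simp [h.G_zero]

end IsCorrectedSR1

section RealEstimates

lemma prod_le_pow_of_sum_le {k : ℕ} {t : ℕ → ℝ} {m : ℝ} (ht : ∀ i, 0 ≤ t i) (hm : 0 < m)
    (hsum : ∑ i ∈ Finset.range k, t i ≤ k * m) : ∏ i ∈ Finset.range k, t i ≤ m ^ k := by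
  calc ∏ i ∈ Finset.range k, t i ≤ ∏ i ∈ Finset.range k, m * Real.exp (t i / m - 1) := by
        refine Finset.prod_le_prod (fun i _ ↦ ht i) fun i _ ↦ ?_
        calc t i = m * (t i / m - 1 + 1) := by field_simp; ring
          _ ≤ _ := mul_le_mul_of_nonneg_left (Real.add_one_le_exp _) hm.le
    _ = m ^ k * Real.exp ((∑ i ∈ Finset.range k, t i) / m - k) := by
        rw [Finset.prod_mul_distrib, ← Real.exp_sum, Finset.sum_sub_distrib, Finset.sum_div]
        simp
    _ ≤ m ^ k * 1 := by
        refine mul_le_mul_of_nonneg_left (Real.exp_le_one_iff.2 ?_) (by positivity)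
        rw [sub_nonpos, div_le_iff₀ hm]
        exact hsum
    _ = m ^ k := mul_one _

lemma log_three_halves_le : Real.log (3 / 2) ≤ 203 / 500 := by
  rw [Real.log_le_iff_le_exp (by norm_num)]
  refine le_trans ?_ (Real.sum_le_exp_of_nonneg (by norm_num) 5)
  norm_num [Finset.sum_range_succ, Nat.factorial]

lemma exp_sixty_five_hundredths_le : Real.exp (13 / 20) ≤ 48 / 25 := by
  refine le_of_pow_le_pow_left₀ (n := 20) (by norm_num) (by norm_num) ?_
  rw [← Real.exp_nat_mul]
  calc Real.exp ((20 : ℕ) * (13 / 20)) = Real.exp 1 ^ 13 := by rw [← Real.exp_nat_mul]; norm_num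
    _ ≤ 2.7182818286 ^ 13 := by gcongr; exact Real.exp_one_lt_d9.le
    _ ≤ _ := by norm_num

lemma linear_factor_le {κ a b P : ℝ} (hκ : 1 ≤ κ) (ha : 0 ≤ a) (haκ : a * κ ≤ 27 / 250)
    (hb : 0 ≤ b) (hb' : b ≤ 27 / 250) (hP1 : 1 ≤ P) (hP : P ≤ 48 / 25) :
    (1 + b / 2) * (1 + a / 2) ≤ 2 ∧ 0 ≤ 1 - (2 - (1 + b / 2) * (1 + a / 2)) / (P * κ) ∧
      (1 + a / 2) ^ 2 * (1 - (2 - (1 + b / 2) * (1 + a / 2)) / (P * κ)) ≤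
        (1 - 1 / (6 * κ)) ^ 2 := by
  have hκ0 : 0 < κ := by linarith
  have ha' : a ≤ 27 / 250 := by nlinarith
  have hc : (1 + b / 2) * (1 + a / 2) ≤ 139 / 125 := by nlinarith
  have hc1 : 1 ≤ (1 + b / 2) * (1 + a / 2) := by nlinarith
  set c := (1 + b / 2) * (1 + a / 2)
  have hPκ : 0 < P * κ := by positivity
  refine ⟨by linarith, ?_, ?_⟩
  · rw [sub_nonneg, div_le_one hPκ]
    nlinarith
  set z := 1 / κ with hz
  have hzpos : 0 < z := by positivity
  have hz1 : z ≤ 1 := by rw [hz, div_le_one hκ0]; exact hκ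
  have haz : a ≤ 27 / 250 * z := by rw [hz, mul_one_div, le_div_iff₀ hκ0]; exact haκ
  have h1 : 37 / 80 * z ≤ (2 - c) / (P * κ) := by
    rw [hz, mul_one_div, div_le_div_iff₀ hκ0 hPκ]
    have : 37 / 80 * P ≤ 2 - c := by linarith
    nlinarith
  have h2 : (1 + a / 2) ^ 2 ≤ 1 + 111 / 1000 * z := by nlinarith
  have h3 : 1 / (6 * κ) = z / 6 := by rw [hz]; field_simp
  rw [h3]
  calc _ ≤ (1 + 111 / 1000 * z) * (1 - 37 / 80 * z) :=
        mul_le_mul h2 (by linarith) (by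
          rw [sub_nonneg, div_le_one hPκ]; nlinarith) (by linarith)
    _ ≤ _ := by nlinarith

end RealEstimates

namespace IsCorrectedSR1

variable {n : ℕ} {f : (Fin n → ℝ) → ℝ} {μ L M : ℝ} {x : ℕ → Fin n → ℝ}
  {G : ℕ → Matrix (Fin n) (Fin n) ℝ} {r rm : ℕ → ℝ}

lemma one_le_cond (h : IsCorrectedSR1 f μ L M x G r rm) : 1 ≤ L / μ :=
  (one_le_div h.mu_pos).2 h.mu_le

lemma sum_average_add (h : IsCorrectedSR1 f μ L M x G r rm) (k : ℕ) :
    ∑ i ∈ Finset.range k, (M * rm i / 2 + M * r i / 2) + M * rm k / 2 =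
      ∑ i ∈ Finset.range k, M * r i := by
  induction k with
  | zero => simp [h.rm_zero]
  | succ k ih => rw [Finset.sum_range_succ, Finset.sum_range_succ, ← ih, h.rm_succ]; ring

lemma sum_average_le (h : IsCorrectedSR1 f μ L M x G r rm) (k : ℕ) :
    ∑ i ∈ Finset.range k, (M * rm i / 2 + M * r i / 2) ≤ ∑ i ∈ Finset.range k, M * r i := by
  linarith [h.sum_average_add k, h.M_mul_rm_nonneg k]

lemma prod_le_exp (h : IsCorrectedSR1 f μ L M x G r rm) (k : ℕ) :
    ∏ i ∈ Finset.range k, (1 + M * rm i / 2) * (1 + M * r i / 2) ≤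
      Real.exp (∑ i ∈ Finset.range k, M * r i) := by
  refine le_trans ?_ (Real.exp_le_exp.2 (h.sum_average_le k))
  rw [Real.exp_sum]
  refine Finset.prod_le_prod (fun i _ ↦ zero_le_one.trans (h.one_le_corr i)) fun i _ ↦ ?_
  have h1 := h.M_mul_r_nonneg i
  rw [Real.exp_add]
  refine mul_le_mul ?_ ?_ (by linarith) (Real.exp_pos _).le
  · linarith [Real.add_one_le_exp (M * rm i / 2)]
  · linarith [Real.add_one_le_exp (M * r i / 2)]

lemma one_le_prod (h : IsCorrectedSR1 f μ L M x G r rm) (k : ℕ) :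
    1 ≤ ∏ i ∈ Finset.range k, (1 + M * rm i / 2) * (1 + M * r i / 2) := by
  calc (1 : ℝ) = ∏ _i ∈ Finset.range k, 1 := by simp
    _ ≤ _ := Finset.prod_le_prod (fun _ _ ↦ zero_le_one) fun i _ ↦ h.one_le_corr i

/-- Linear convergence from a starting point with `M * λ_f(x₀)` of order `μ / L`. -/
lemma linear_convergence (h : IsCorrectedSR1 f μ L M x G r rm)
    (hloc : M * lamG f (x 0) ≤ Real.log (3 / 2) / (4 * (L / μ))) (k : ℕ) :
    lamG f (x k) ≤ (1 - 1 / (6 * (L / μ))) ^ k * lamG f (x 0) ∧ M * rm k ≤ 27 / 250 ∧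
      ∑ i ∈ Finset.range k, M * r i ≤
        159 / 25 * (M * lamG f (x 0) * (L / μ)) * (1 - (1 - 1 / (6 * (L / μ))) ^ k) := by
  have hκ := h.one_le_cond
  set κ := L / μ
  have hκ0 : 0 < κ := by linarith
  set ε := M * lamG f (x 0) with hε
  have hε0 : 0 ≤ ε := mul_nonneg h.M_nonneg (Real.sqrt_nonneg _)
  have hεκ : ε * κ ≤ 203 / 2000 := by
    rw [le_div_iff₀ (by positivity)] at hloc
    linarith [log_three_halves_le]
  set s := 1 - 1 / (6 * κ) with hs
  have hs0 : 0 ≤ s := by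
    rw [hs, sub_nonneg, div_le_one (by positivity)]
    linarith
  have hs1 : s ≤ 1 := by rw [hs]; linarith [show 0 < 1 / (6 * κ) by positivity]
  induction k with
  | zero => simp [h.rm_zero]; norm_num
  | succ k ih =>
    obtain ⟨hl, hb, hsum⟩ := ih
    have hsk0 : 0 ≤ s ^ k := pow_nonneg hs0 k
    have hsk1 : s ^ k ≤ 1 := pow_le_one₀ hs0 hs1
    have hb0 := h.M_mul_rm_nonneg k
    have ha0 := h.M_mul_r_nonneg k
    have ha : M * r k ≤ 53 / 50 * (s ^ k * ε) := by
      calc M * r k ≤ M * ((1 + M * rm k / 2) * lamG f (x k)) :=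
            mul_le_mul_of_nonneg_left (h.r_le k) h.M_nonneg
        _ = (1 + M * rm k / 2) * (M * lamG f (x k)) := by ring
        _ ≤ 53 / 50 * (M * (s ^ k * lamG f (x 0))) :=
            mul_le_mul (by linarith) (mul_le_mul_of_nonneg_left hl h.M_nonneg)
              (mul_nonneg h.M_nonneg (Real.sqrt_nonneg _)) (by norm_num)
        _ = _ := by rw [hε]; ring
    have haκ : M * r k * κ ≤ 27 / 250 := by
      have h1 : M * r k ≤ 53 / 50 * ε := ha.trans (by nlinarith)
      nlinarith
    have hS : ∑ i ∈ Finset.range k, M * r i ≤ 13 / 20 := by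
      refine hsum.trans ?_
      have : 0 ≤ ε * κ := by positivity
      nlinarith
    have hP : ∏ i ∈ Finset.range k, (1 + M * rm i / 2) * (1 + M * r i / 2) ≤ 48 / 25 :=
      (h.prod_le_exp k).trans ((Real.exp_le_exp.2 hS).trans exp_sixty_five_hundredths_le)
    obtain ⟨hc, hq, hlin⟩ := linear_factor_le hκ ha0 haκ hb0 hb (h.one_le_prod k) hP
    refine ⟨?_, ?_, ?_⟩
    · have h1 := h.lamG_succ_sq_le k hc hq
      have h2 : lamG f (x (k + 1)) ≤ s * lamG f (x k) := by
        refine le_of_sq_le_sq ?_ (mul_nonneg hs0 (Real.sqrt_nonneg _))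
        rw [mul_pow]
        exact h1.trans (mul_le_mul_of_nonneg_right hlin (sq_nonneg _))
      calc _ ≤ s * lamG f (x k) := h2
        _ ≤ s * (s ^ k * lamG f (x 0)) := mul_le_mul_of_nonneg_left hl hs0
        _ = _ := by ring
    · rw [h.rm_succ]
      nlinarith
    · rw [Finset.sum_range_succ]
      have : 159 / 25 * (ε * κ) * (1 - s ^ (k + 1)) =
          159 / 25 * (ε * κ) * (1 - s ^ k) + 53 / 50 * (s ^ k * ε) := by
        rw [pow_succ, hs]
        field_simp
        ring
      linarith

lemma sum_r_le (h : IsCorrectedSR1 f μ L M x G r rm)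
    (hloc : M * lamG f (x 0) ≤ Real.log (3 / 2) / (4 * (L / μ))) (k : ℕ) :
    ∑ i ∈ Finset.range k, M * r i ≤ 13 / 20 := by
  refine (h.linear_convergence hloc k).2.2.trans ?_
  have hκ := h.one_le_cond
  have hε0 : 0 ≤ M * lamG f (x 0) := mul_nonneg h.M_nonneg (Real.sqrt_nonneg _)
  rw [le_div_iff₀ (by positivity)] at hloc
  have hs0 : 0 ≤ (1 - 1 / (6 * (L / μ))) ^ k := by
    refine pow_nonneg ?_ k
    rw [sub_nonneg, div_le_one (by positivity)]
    linarith
  have : 0 ≤ M * lamG f (x 0) * (L / μ) := by positivity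
  nlinarith [log_three_halves_le]

lemma sum_sq_corr_le (h : IsCorrectedSR1 f μ L M x G r rm)
    (hloc : M * lamG f (x 0) ≤ Real.log (3 / 2) / (4 * (L / μ))) (k : ℕ) :
    ∑ i ∈ Finset.range k, ((1 + M * rm i / 2) * (1 + M * r i / 2) - 1) ^ 2 ≤ 13 / 20 := by
  refine le_trans (Finset.sum_le_sum fun i _ ↦ ?_)
    ((h.sum_average_le k).trans (h.sum_r_le hloc k))
  have ha := h.M_mul_r_nonneg i
  have hb := h.M_mul_rm_nonneg i
  have hb' := (h.linear_convergence hloc i).2.1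
  have ha' := (h.linear_convergence hloc (i + 1)).2.1
  rw [h.rm_succ] at ha'
  set a := M * r i
  set b := M * rm i
  have h0 : 0 ≤ (1 + b / 2) * (1 + a / 2) - 1 := by nlinarith
  have h1 : (1 + b / 2) * (1 + a / 2) - 1 ≤ 2 * (b / 2 + a / 2) := by nlinarith
  have h2 : (1 + b / 2) * (1 + a / 2) - 1 ≤ 1 / 2 := by nlinarith
  nlinarith

lemma prod_det_ratio (h : IsCorrectedSR1 f μ L M x G r rm) (k : ℕ) :
    ∏ i ∈ Finset.range k,
        ((1 + M * rm i / 2) * (1 + M * r i / 2)) ^ n * (G i).det / (G (i + 1)).det =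
      (∏ i ∈ Finset.range k, (1 + M * rm i / 2) * (1 + M * r i / 2)) ^ n * L ^ n /
        (G k).det := by
  simp_rw [mul_div_assoc]
  rw [Finset.prod_mul_distrib, Finset.prod_pow, ← h.det_G_zero]
  congr 1
  induction k with
  | zero => simp [(h.G_posDef 0).det_pos.ne']
  | succ k ih =>
    have := (h.G_posDef k).det_pos.ne'
    rw [Finset.prod_range_succ, ih]
    field_simp

lemma log_prod_det_ratio_le (h : IsCorrectedSR1 f μ L M x G r rm)
    (hloc : M * lamG f (x 0) ≤ Real.log (3 / 2) / (4 * (L / μ))) (k : ℕ) :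
    Real.log (∏ i ∈ Finset.range k,
        ((1 + M * rm i / 2) * (1 + M * r i / 2)) ^ n * (G i).det / (G (i + 1)).det) ≤
      n * (13 / 20 + Real.log (L / μ)) := by
  have hμ := h.mu_pos
  have hL := h.L_pos
  have hP := h.prod_pos k
  have hle := (h.prod_le_exp k).trans (Real.exp_le_exp.2 (h.sum_r_le hloc k))
  rw [h.prod_det_ratio]
  set P := ∏ i ∈ Finset.range k, (1 + M * rm i / 2) * (1 + M * r i / 2)
  have hd := (h.G_posDef k).det_pos
  have : P ^ n * L ^ n / (G k).det ≤ (Real.exp (13 / 20) * (L / μ)) ^ n := by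
    rw [mul_pow, div_pow, mul_div_assoc]
    exact mul_le_mul (by gcongr) (div_le_div_of_nonneg_left (by positivity) (by positivity)
      (h.pow_le_det_G k)) (by positivity) (by positivity)
  refine (Real.log_le_log (by positivity) this).trans_eq ?_
  rw [Real.log_pow, Real.log_mul (by positivity) (by positivity), Real.log_exp]

/-- Superlinear decrease of the gradient in the metric of `(G k)⁻¹`. -/
lemma grad_G_inv_le_pow (h : IsCorrectedSR1 f μ L M x G r rm)
    (hloc : M * lamG f (x 0) ≤ Real.log (3 / 2) / (4 * (L / μ))) {k : ℕ} {m : ℝ} (hm : 0 < m)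
    (hk : n * (13 / 20 + Real.log (L / μ)) + 13 / 20 ≤ k * m) :
    grad f (x k) ⬝ᵥ (G k)⁻¹ *ᵥ grad f (x k) ≤
      m ^ k * Real.exp (n * (13 / 20 + Real.log (L / μ))) *
        (grad f (x 0) ⬝ᵥ (G 0)⁻¹ *ᵥ grad f (x 0)) := by
  set E : ℕ → ℝ := fun i ↦
    ((1 + M * rm i / 2) * (1 + M * r i / 2)) ^ n * (G i).det / (G (i + 1)).det with hE
  set e : ℕ → ℝ := fun i ↦ ((1 + M * rm i / 2) * (1 + M * r i / 2) - 1) ^ 2 with he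
  have hE1 (i : ℕ) : 1 ≤ E i :=
    (one_le_div (h.G_posDef (i + 1)).det_pos).2 (h.det_succ_le i)
  have hlog := h.log_prod_det_ratio_le hloc k
  change Real.log (∏ i ∈ Finset.range k, E i) ≤ _ at hlog
  have ht (i : ℕ) : 0 ≤ e i + Real.log (E i) :=
    add_nonneg (sq_nonneg _) (Real.log_nonneg (hE1 i))
  have hEpos (i : ℕ) : 0 < E i := zero_lt_one.trans_le (hE1 i)
  have hprodpos : 0 < ∏ i ∈ Finset.range k, E i := Finset.prod_pos fun i _ ↦ hEpos i
  have hstep (i : ℕ) : e i + (E i - 1) ≤ (e i + Real.log (E i)) * E i := by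
    have h1 : E i - 1 ≤ Real.log (E i) * E i := by
      have := Real.one_sub_inv_le_log_of_pos (hEpos i)
      have := mul_le_mul_of_nonneg_right this (hEpos i).le
      rwa [sub_mul, one_mul, inv_mul_cancel₀ (hEpos i).ne'] at this
    have h2 : e i ≤ e i * E i := le_mul_of_one_le_right (sq_nonneg _) (hE1 i)
    linarith
  have hprod (j : ℕ) : grad f (x j) ⬝ᵥ (G j)⁻¹ *ᵥ grad f (x j) ≤
      (∏ i ∈ Finset.range j, (e i + Real.log (E i)) * E i) *
        (grad f (x 0) ⬝ᵥ (G 0)⁻¹ *ᵥ grad f (x 0)) := by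
    induction j with
    | zero => simp
    | succ j ih =>
      have h0 : 0 ≤ (e j + Real.log (E j)) * E j := mul_nonneg (ht j) (hEpos j).le
      calc _ ≤ (e j + (E j - 1)) * (grad f (x j) ⬝ᵥ (G j)⁻¹ *ᵥ grad f (x j)) :=
            h.grad_G_inv_succ_le j
        _ ≤ (e j + Real.log (E j)) * E j * (grad f (x j) ⬝ᵥ (G j)⁻¹ *ᵥ grad f (x j)) :=
            mul_le_mul_of_nonneg_right (hstep j) (h.grad_G_inv_nonneg j)
        _ ≤ _ := mul_le_mul_of_nonneg_left ih h0
        _ = _ := by rw [Finset.prod_range_succ]; ring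
  refine (hprod k).trans (mul_le_mul_of_nonneg_right ?_ (h.grad_G_inv_nonneg 0))
  rw [Finset.prod_mul_distrib]
  refine mul_le_mul (prod_le_pow_of_sum_le ht hm ?_)
    ((Real.log_le_iff_le_exp hprodpos).1 hlog) hprodpos.le (by positivity)
  rw [Finset.sum_add_distrib, ← Real.log_prod fun i _ ↦ (hEpos i).ne']
  linarith [h.sum_sq_corr_le hloc k]

lemma superlinear_convergence (h : IsCorrectedSR1 f μ L M x G r rm)
    (hloc : M * lamG f (x 0) ≤ Real.log (3 / 2) / (4 * (L / μ))) (hn : n ≠ 0) {k : ℕ}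
    (hk : 4 * (n : ℝ) * Real.log (Real.exp 1 * (L / μ)) / Real.log 2 < k) :
    lamG f (x k) ≤
      (4 * (n : ℝ) * Real.log (Real.exp 1 * (L / μ)) / k) ^ ((k : ℝ) / 2) *
        Real.sqrt (3 * (L / μ)) * lamG f (x 0) := by
  have hκ := h.one_le_cond
  have hPle := (h.prod_le_exp k).trans
    ((Real.exp_le_exp.2 (h.sum_r_le hloc k)).trans exp_sixty_five_hundredths_le)
  have hσ0 := h.grad_G_inv_le 0
  have hσ0' := h.grad_G_inv_nonneg 0
  have hlam := h.lamG_sq_le k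
  have hσk := h.grad_G_inv_nonneg k
  rw [h.rm_zero, mul_zero, zero_div, add_zero, one_mul] at hσ0
  have hlogκ : 0 ≤ Real.log (L / μ) := Real.log_nonneg hκ
  rw [Real.log_mul (Real.exp_pos _).ne' (by positivity), Real.log_exp] at hk ⊢
  set κ := L / μ
  set l := Real.log κ
  have hn1 : (1 : ℝ) ≤ n := by exact_mod_cast Nat.one_le_iff_ne_zero.2 hn
  have hl2 : 0 < Real.log 2 := Real.log_pos (by norm_num)
  rw [div_lt_iff₀ hl2] at hk
  have hk0 : (0 : ℝ) < k := by
    have : 0 < 4 * (n : ℝ) * (1 + l) := by positivity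
    exact pos_of_mul_pos_left (this.trans hk) hl2.le
  have hX : 0 ≤ 4 * (n : ℝ) * (1 + l) / k := by positivity
  have hexp : Real.exp (n * (13 / 20 + l)) ≤ 2 ^ k := by
    rw [← Real.exp_log (show (0 : ℝ) < 2 ^ k by positivity), Real.log_pow]
    refine Real.exp_le_exp.2 ?_
    nlinarith
  have hσ' := h.grad_G_inv_le_pow (k := k) hloc (m := 2 * n * (1 + l) / k) (by positivity) (by
    rw [mul_div_cancel₀ _ hk0.ne']
    nlinarith)
  have hpow : (2 * n * (1 + l) / k) ^ k * 2 ^ k = (4 * (n : ℝ) * (1 + l) / k) ^ k := by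
    rw [← mul_pow]; ring
  refine le_of_sq_le_sq ?_ (by unfold lamG; positivity)
  rw [mul_pow, mul_pow, Real.sq_sqrt (by positivity), ← Real.rpow_natCast (_ ^ _) 2,
    ← Real.rpow_mul hX, Nat.cast_ofNat, div_mul_cancel₀ _ two_ne_zero, Real.rpow_natCast, ← hpow]
  calc lamG f (x k) ^ 2 ≤ 3 * κ * (grad f (x k) ⬝ᵥ (G k)⁻¹ *ᵥ grad f (x k)) := by
        refine hlam.trans (mul_le_mul_of_nonneg_right ?_ hσk)
        gcongr
        linarith
    _ ≤ 3 * κ * ((2 * n * (1 + l) / k) ^ k * 2 ^ k * lamG f (x 0) ^ 2) := by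
        refine mul_le_mul_of_nonneg_left (hσ'.trans ?_) (by positivity)
        gcongr
    _ = _ := by ring

end IsCorrectedSR1

/-- Corollary 4.2: explicit superlinear convergence of SR1 with correction
strategy: for `Mλ_f(x₀) ≤ ln(3/2)/(4κ)` and all `k > 4n ln(eκ)/ln 2`,
`λ_f(x_k) ≤ (4n ln(eκ)/k)^{k/2} √(3κ) λ_f(x₀)`. -/
theorem sr1_cs_superlinear_rate_clean
    {n : ℕ} (f : (Fin n → ℝ) → ℝ) (μ L M : ℝ)
    (hf : ContDiff ℝ 2 f) (hμ : 0 < μ) (hμL : μ ≤ L) (hM : 0 ≤ M)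
    (hlow : ∀ y : Fin n → ℝ, (hess f y - μ • (1 : Matrix (Fin n) (Fin n) ℝ)).PosSemidef)
    (hup : ∀ y : Fin n → ℝ, (L • (1 : Matrix (Fin n) (Fin n) ℝ) - hess f y).PosSemidef)
    (hssc : StrongSelfConcordant f M)
    (x : ℕ → Fin n → ℝ) (G : ℕ → Matrix (Fin n) (Fin n) ℝ) (r rm : ℕ → ℝ)
    (hG0 : G 0 = L • (1 : Matrix (Fin n) (Fin n) ℝ))
    (hrm0 : rm 0 = 0) (hrmS : ∀ k, rm (k+1) = r k)
    (hx : ∀ k, x (k+1) = x k - (G k)⁻¹ *ᵥ grad f (x k))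
    (hr : ∀ k, r k = znorm f (x k) (x (k+1) - x k))
    (hGS : ∀ k, G (k+1) =
      SR1 (Jmat f x k) (((1 + M * rm k / 2) * (1 + M * r k / 2)) • G k) (x (k+1) - x k))
    (hloc : M * lamG f (x 0) ≤ Real.log (3 / 2) / (4 * (L / μ))) :
    ∀ k : ℕ, 4 * (n : ℝ) * Real.log (Real.exp 1 * (L / μ)) / Real.log 2 < (k : ℝ) →
      lamG f (x k) ≤
        (4 * (n : ℝ) * Real.log (Real.exp 1 * (L / μ)) / (k : ℝ)) ^ ((k : ℝ) / 2) *
          Real.sqrt (3 * (L / μ)) * lamG f (x 0) := by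
  intro k hk
  rcases eq_or_ne n 0 with rfl | hn
  · have h0 (y : Fin 0 → ℝ) : lamG f y = 0 := by simp [lamG]
    simp [h0]
  · exact IsCorrectedSR1.superlinear_convergence
      ⟨hf, hμ, hμL, hM, hlow, hup, hssc, hG0, hrm0, hrmS, hx, hr, hGS⟩ hloc hn hk
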